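/- arXiv:2512.12350 — 12 statements merged into one kernel-verified Lean document; each statement's English description precedes it below -/
import Mathlib

section
/- Let A be a Hopf algebra over a field k. Suppose h ∈ A is a nonzero left cointegral with ε(h) = 1 and k₀ ∈ A is a nonzero right cointegral. Then h·h = h, k₀ = ε(k₀)·h, ε(k₀) ≠ 0, and h is itself also a right cointegral, i.e. h·a = ε(a)·h for all a ∈ A. -/
open Coalgebra HopfAlgebra

/-- If `h` is a nonzero left cointegral with `ε h = 1` and `k₀` is a nonzero
right cointegral in a Hopf algebra `A` over a field `k`, then `h * h = h`,
`k₀ = ε k₀ • h`, `ε k₀ ≠ 0`, and `h` is also a right cointegral. -/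
theorem stmt0 {k A : Type*} [Field k] [Ring A] [HopfAlgebra k A]
    (h k₀ : A) (hh : h ≠ 0) (hleft : ∀ a : A, a * h = counit (R := k) a • h)
    (hcounit : counit (R := k) h = 1)
    (hk : k₀ ≠ 0) (hright : ∀ a : A, k₀ * a = counit (R := k) a • k₀) :
    h * h = h ∧ k₀ = counit (R := k) k₀ • h ∧ counit (R := k) k₀ ≠ 0 ∧
      ∀ a : A, h * a = counit (R := k) a • h := by
  have h1 : k₀ = counit (R := k) k₀ • h := by
    rw [← hleft k₀, hright h, hcounit, one_smul]
  have h2 : counit (R := k) k₀ ≠ 0 := by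
    intro h0
    rw [h0, zero_smul] at h1
    exact hk h1
  refine ⟨by rw [hleft h, hcounit, one_smul], h1, h2, fun a => ?_⟩
  have h3 : h = (counit (R := k) k₀)⁻¹ • k₀ := by
    conv_rhs => rw [h1]
    rw [map_smul, hcounit, smul_eq_mul, mul_one, inv_smul_smul₀ h2]
  have h4 := hright a
  calc h * a = ((counit (R := k) k₀)⁻¹ • k₀) * a := by rw [← h3]
    _ = counit (R := k) a • ((counit (R := k) k₀)⁻¹ • k₀) := by
      rw [smul_mul_assoc, h4, smul_comm]
    _ = counit (R := k) a • h := by rw [← h3]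
end

section
/- Let A be a Hopf algebra over a field k. Suppose h ∈ A is a nonzero left cointegral with ε(h) = 1 and that A possesses some nonzero right cointegral. Then every left cointegral h' ∈ A satisfies h' = ε(h')·h; in particular every nonzero left cointegral h' has ε(h') ≠ 0, and h is the unique nonzero left cointegral with counit value 1. -/
open Coalgebra HopfAlgebra

/-- If `h` is a nonzero left cointegral with `ε h = 1` and `A` has a nonzero
right cointegral, then every left cointegral `h'` satisfies `h' = ε h' • h`; in particular
nonzero left cointegrals have `ε h' ≠ 0`, and `h` is the unique nonzero left cointegral with
counit value `1`. -/
theorem stmt1 {k A : Type*} [Field k] [Ring A] [HopfAlgebra k A]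
    (h : A) (hh : h ≠ 0) (hleft : ∀ a : A, a * h = counit (R := k) a • h)
    (hcounit : counit (R := k) h = 1)
    (hex : ∃ k₀ : A, k₀ ≠ 0 ∧ ∀ a : A, k₀ * a = counit (R := k) a • k₀) :
    (∀ h' : A, (∀ a : A, a * h' = counit (R := k) a • h') → h' = counit (R := k) h' • h) ∧
    (∀ h' : A, h' ≠ 0 → (∀ a : A, a * h' = counit (R := k) a • h') →
      counit (R := k) h' ≠ 0) ∧
    (∀ h' : A, h' ≠ 0 → (∀ a : A, a * h' = counit (R := k) a • h') →
      counit (R := k) h' = 1 → h' = h) := by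
  obtain ⟨k₀, hk, hr⟩ := hex
  have h1 : k₀ = counit (R := k) k₀ • h := by
    have := hr h
    rw [hleft, hcounit, one_smul] at this
    exact this.symm
  have hc : counit (R := k) k₀ ≠ 0 := by
    intro h0
    rw [h0, zero_smul] at h1
    exact hk h1
  have main : ∀ h' : A, (∀ a : A, a * h' = counit (R := k) a • h') →
      h' = counit (R := k) h' • h := by
    intro h' hl
    have h2 := (hl k₀).symm.trans (hr h')
    have h3 : counit (R := k) h' • k₀ = counit (R := k) k₀ • (counit (R := k) h' • h) := by
      rw [smul_comm, ← h1]
    exact smul_right_injective A hc (h2.trans h3)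
  refine ⟨main, ?_, ?_⟩
  · intro h' hn hl h0
    have := main h' hl
    rw [h0, zero_smul] at this
    exact hn this
  · intro h' _ hl h1'
    have := main h' hl
    rw [h1', one_smul] at this
    exact this
end

section
/- Let A be a Hopf algebra over a field k and let h ∈ A be a left cointegral. Then for every a ∈ A one has (1 ⊗ a)·Δ(h) = (S(a) ⊗ 1)·Δ(h) in the algebra A ⊗ A. -/
open Coalgebra HopfAlgebra TensorProduct

/-- `Σ (S(a₁) ⊗ 1) Δ(a₂) = 1 ⊗ a`. -/
theorem stmt4_aux {k A : Type*} [Field k] [Ring A] [HopfAlgebra k A] (a : A) :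
    (TensorProduct.lift (LinearMap.mul k (A ⊗[k] A) ∘ₗ
      (TensorProduct.mk k A A).flip 1 ∘ₗ antipode k))
      ((comul (R := k)).lTensor A (comul (R := k) a)) = (1 : A) ⊗ₜ[k] a := by
  rw [← coassoc_apply]
  have e : (TensorProduct.lift (LinearMap.mul k (A ⊗[k] A) ∘ₗ
      (TensorProduct.mk k A A).flip 1 ∘ₗ antipode k)) ∘ₗ
      (TensorProduct.assoc k A A A).toLinearMap =
      (LinearMap.mul' k A ∘ₗ (antipode k).rTensor A).rTensor A := by
    ext x y z
    simp
  have e' := LinearMap.congr_fun e ((comul (R := k)).rTensor A (comul (R := k) a))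
  rw [LinearMap.comp_apply] at e'
  refine e'.trans ?_
  rw [← LinearMap.comp_apply, ← LinearMap.rTensor_comp, LinearMap.comp_assoc,
    HopfAlgebra.mul_antipode_rTensor_comul, LinearMap.rTensor_comp, LinearMap.comp_apply,
    rTensor_counit_comul]
  simp

/-- For a left cointegral `h` in a Hopf algebra `A` over a field `k` and any
`a ∈ A`, one has `(1 ⊗ a) * Δ(h) = (S(a) ⊗ 1) * Δ(h)` in `A ⊗[k] A`. -/
theorem stmt4 {k A : Type*} [Field k] [Ring A] [HopfAlgebra k A]
    (h : A) (hh : h ≠ 0) (hleft : ∀ a : A, a * h = counit (R := k) a • h) :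
    ∀ a : A, ((1 : A) ⊗ₜ[k] a) * comul (R := k) h =
      (antipode (R := k) a ⊗ₜ[k] (1 : A)) * comul (R := k) h := by
  intro a
  have key : ∀ t : A ⊗[k] A,
      (TensorProduct.lift (LinearMap.mul k (A ⊗[k] A) ∘ₗ
        (TensorProduct.mk k A A).flip 1 ∘ₗ antipode k))
        ((comul (R := k)).lTensor A t) * comul (R := k) h =
      (antipode (R := k) (TensorProduct.rid k A ((counit (R := k)).lTensor A t)) ⊗ₜ[k] (1 : A))
        * comul (R := k) h := by
    intro t
    induction t with
    | zero => simp
    | add x y hx hy => simp only [map_add, add_mul, hx, hy, TensorProduct.add_tmul]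
    | tmul x y =>
      have e : comul (R := k) y * comul (R := k) h =
          counit (R := k) y • comul (R := k) h := by
        rw [← Bialgebra.comul_mul, hleft, map_smul]
      simp [mul_assoc, e]
      rw [← TensorProduct.smul_tmul', smul_mul_assoc]
  have := key (comul (R := k) a)
  rw [stmt4_aux, lTensor_counit_comul] at this
  simpa using this
end

section
/- Let A be a Hopf algebra over a field k and let k₀ ∈ A be a right cointegral. Then for every a ∈ A one has Δ(k₀)·(a ⊗ 1) = Δ(k₀)·(1 ⊗ S(a)) in the algebra A ⊗ A. -/
open Coalgebra HopfAlgebra TensorProduct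

/-- For a right cointegral `k₀` in a Hopf algebra `A` over a field `k` and any
`a ∈ A`, one has `Δ(k₀) * (a ⊗ 1) = Δ(k₀) * (1 ⊗ S(a))` in `A ⊗[k] A`. -/
theorem stmt5 {k A : Type*} [Field k] [Ring A] [HopfAlgebra k A]
    (k₀ : A) (hk : k₀ ≠ 0) (hright : ∀ a : A, k₀ * a = counit (R := k) a • k₀) :
    ∀ a : A, comul (R := k) k₀ * (a ⊗ₜ[k] (1 : A)) =
      comul (R := k) k₀ * ((1 : A) ⊗ₜ[k] antipode (R := k) a) := by
  intro a
  let M : A ⊗[k] A →ₗ[k] A := LinearMap.mul' k A ∘ₗ (antipode k).lTensor A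
  let F : A ⊗[k] (A ⊗[k] A) →ₗ[k] A ⊗[k] A := M.lTensor A
  have h1 : F ((comul (R := k)).lTensor A (comul (R := k) a)) = a ⊗ₜ[k] (1 : A) := by
    have e : M ∘ₗ comul = (Algebra.linearMap k A) ∘ₗ counit :=
      HopfAlgebra.mul_antipode_lTensor_comul
    have : F ((comul (R := k)).lTensor A (comul (R := k) a))
        = (M ∘ₗ comul).lTensor A (comul (R := k) a) := by
      rw [LinearMap.lTensor_comp]; rfl
    rw [this, e, LinearMap.lTensor_comp, LinearMap.comp_apply,
      Coalgebra.lTensor_counit_comul]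
    simp
  have h2 : ∀ (t : A ⊗[k] A) (y : A),
      F (TensorProduct.assoc k A A A (t ⊗ₜ y)) = t * ((1 : A) ⊗ₜ[k] antipode k y) := by
    intro t y
    induction t with
    | zero => simp
    | add s t hs ht => simp only [TensorProduct.add_tmul, map_add, hs, ht, add_mul]
    | tmul u v => simp [F, M]
  have h3 : ∀ w : A ⊗[k] A,
      comul (R := k) k₀ * F (TensorProduct.assoc k A A A ((comul (R := k)).rTensor A w)) =
      comul (R := k) k₀ * ((1 : A) ⊗ₜ[k]
        antipode k (TensorProduct.lid k A ((counit (R := k)).rTensor A w))) := by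
    intro w
    induction w with
    | zero => simp
    | add s t hs ht => simp only [map_add, mul_add, hs, ht, TensorProduct.tmul_add]
    | tmul u v =>
      rw [LinearMap.rTensor_tmul, h2, ← mul_assoc, ← Bialgebra.comul_mul, hright]
      simp
  rw [← h1, ← Coalgebra.coassoc_apply, h3, Coalgebra.rTensor_counit_comul]
  simp
end

section
/- Let A be a Hopf algebra over a field k whose antipode S is bijective, and let h ∈ A be a nonzero left cointegral. Then both legs of Δ(h) span A: for every linear functional ρ : A → k, if (ρ ⊗ id)(Δ(h)) = 0 (in k ⊗ A ≅ A) then ρ = 0, and likewise if (id ⊗ ρ)(Δ(h)) = 0 then ρ = 0. -/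
open Coalgebra HopfAlgebra TensorProduct

/-- `S(a₁) a₂ ⊗ a₃ = 1 ⊗ a`. -/
lemma aux_cancel {k A : Type*} [Field k] [Ring A] [HopfAlgebra k A] (a : A) :
    (LinearMap.rTensor A (LinearMap.mul' k A ∘ₗ (antipode k).rTensor A))
      ((TensorProduct.assoc k A A A).symm (comul.lTensor A (comul (R := k) a))) =
    (1 : A) ⊗ₜ[k] a := by
  rw [coassoc_symm_apply, ← LinearMap.comp_apply, ← LinearMap.rTensor_comp,
    LinearMap.comp_assoc, mul_antipode_rTensor_comul, LinearMap.rTensor_comp,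
    LinearMap.comp_apply, rTensor_counit_comul]
  simp

lemma aux_key {k A : Type*} [Field k] [Ring A] [HopfAlgebra k A]
    (h : A) (hleft : ∀ a : A, a * h = counit (R := k) a • h) (a : A) :
    ((1 : A) ⊗ₜ[k] a) * comul (R := k) h = (antipode k a ⊗ₜ[k] (1 : A)) * comul (R := k) h := by
  have h1 : ∀ x : A, ∀ w : A ⊗[k] A,
      (LinearMap.rTensor A (LinearMap.mul' k A ∘ₗ (antipode k).rTensor A))
      ((TensorProduct.assoc k A A A).symm (x ⊗ₜ w)) = (antipode k x ⊗ₜ[k] (1 : A)) * w := by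
    intro x w
    induction w with
    | zero => simp
    | tmul y z => simp
    | add u v hu hv => simp only [tmul_add, map_add, hu, hv, mul_add]
  have h2 : ∀ t : A ⊗[k] A,
      (LinearMap.rTensor A (LinearMap.mul' k A ∘ₗ (antipode k).rTensor A))
      ((TensorProduct.assoc k A A A).symm (comul.lTensor A t)) * comul (R := k) h =
      (antipode k (TensorProduct.rid k A (counit.lTensor A t)) ⊗ₜ[k] (1 : A))
        * comul (R := k) h := by
    intro t
    induction t with
    | zero => simp
    | tmul y z =>
      rw [LinearMap.lTensor_tmul, h1, mul_assoc, ← Bialgebra.comul_mul, hleft]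
      simp [← smul_tmul', smul_mul_assoc]
    | add u v hu hv => simp only [map_add, add_mul, hu, hv, add_tmul]
  have := h2 (comul a)
  rw [aux_cancel] at this
  simpa using this

theorem stmt6 {k A : Type*} [Field k] [Ring A] [HopfAlgebra k A]
    (hS : Function.Bijective (antipode (R := k) (A := A)))
    (h : A) (hh : h ≠ 0) (hleft : ∀ a : A, a * h = counit (R := k) a • h) :
    (∀ ρ : A →ₗ[k] k, (LinearMap.rTensor A ρ) (comul (R := k) h) = 0 → ρ = 0) ∧
    (∀ ρ : A →ₗ[k] k, (LinearMap.lTensor A ρ) (comul (R := k) h) = 0 → ρ = 0) := by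
  obtain ⟨φ, hφ⟩ : ∃ φ : A →ₗ[k] k, φ h ≠ 0 := by
    by_contra! hc
    exact hh ((Module.forall_dual_apply_eq_zero_iff k h).1 hc)
  let B := Module.Basis.ofVectorSpace k A
  constructor
  · intro ρ hρ
    have e1 : ∀ b : A, (LinearMap.rTensor A (ρ ∘ₗ LinearMap.mulLeft k b)) (comul (R := k) h) = 0 := by
      intro b
      obtain ⟨a, rfl⟩ := hS.2 b
      have g1 : ∀ t : A ⊗[k] A, (LinearMap.rTensor A (ρ ∘ₗ LinearMap.mulLeft k (antipode k a))) t
          = LinearMap.rTensor A ρ ((antipode k a ⊗ₜ[k] (1 : A)) * t) := by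
        intro t
        induction t with
        | zero => simp
        | tmul y z => simp
        | add u v hu hv => simp only [map_add, mul_add, hu, hv]
      have g2 : ∀ t : A ⊗[k] A, LinearMap.rTensor A ρ (((1 : A) ⊗ₜ[k] a) * t)
          = LinearMap.lTensor k (LinearMap.mulLeft k a) (LinearMap.rTensor A ρ t) := by
        intro t
        induction t with
        | zero => simp
        | tmul y z => simp
        | add u v hu hv => simp only [map_add, mul_add, hu, hv]
      rw [g1, ← aux_key h hleft, g2, hρ, map_zero]
    obtain ⟨c, hc⟩ := TensorProduct.eq_repr_basis_right (M := A) B (comul (R := k) h)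
    have e2 : ∀ b i, ρ (b * c i) = 0 := by
      intro b i
      have := e1 b
      rw [← hc, Finsupp.sum, map_sum] at this
      have h0 := TensorProduct.sum_tmul_basis_right_eq_zero (R := k) B
        (c.mapRange (ρ ∘ₗ LinearMap.mulLeft k b) (map_zero _)) (by
          rw [Finsupp.sum_mapRange_index (by simp)]
          simpa [Finsupp.sum] using this)
      simpa using DFunLike.congr_fun h0 i
    let T := (LinearEquiv.ofBijective (antipode k (A := A)) hS).symm
    have hT : ∀ x, antipode k (T x) = x := fun x =>
      (LinearEquiv.ofBijective (antipode k (A := A)) hS).apply_symm_apply x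
    let m : A ⊗[k] A →ₗ[k] A := LinearMap.mul' k A ∘ₗ T.toLinearMap.rTensor A ∘ₗ
      (TensorProduct.comm k A A).toLinearMap
    have hm : ∀ x : A, m (comul x) = algebraMap k A (counit x) := by
      intro x
      apply hS.1
      have : ∀ t : A ⊗[k] A, antipode k (m t) = LinearMap.mul' k A ((antipode k).rTensor A t) := by
        intro t
        induction t with
        | zero => simp
        | tmul y z => simp [m, antipode_mul_antidistrib, hT]
        | add u v hu hv => simp only [map_add, hu, hv]
      rw [this, mul_antipode_rTensor_comul_apply]
      simp [Algebra.algebraMap_eq_smul_one]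
    ext b
    let Ω : (A ⊗[k] A) ⊗[k] A →ₗ[k] k := LinearMap.mul' k k ∘ₗ
      TensorProduct.map (ρ ∘ₗ LinearMap.mulLeft k b ∘ₗ m) φ
    have l1 : ∀ t : A ⊗[k] A, Ω (comul.rTensor A t) =
        ρ b * φ (TensorProduct.lid k A (counit.rTensor A t)) := by
      intro t
      induction t with
      | zero => simp
      | tmul y z => simp [Ω, hm, Algebra.algebraMap_eq_smul_one]; ring
      | add u v hu hv => simp only [map_add, mul_add, hu, hv]
    have l2 : ∀ i, ∀ w : A ⊗[k] A, Ω ((TensorProduct.assoc k A A A).symm (c i ⊗ₜ w)) = 0 := by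
      intro i w
      induction w with
      | zero => simp
      | tmul y z => simp [Ω, m, ← mul_assoc, e2]
      | add u v hu hv => simp only [tmul_add, map_add, hu, hv, add_zero]
    have l3 := l1 (comul h)
    have l4 : Ω ((TensorProduct.assoc k A A A).symm (comul.lTensor A (comul h))) = 0 := by
      rw [← hc, Finsupp.sum, map_sum, map_sum, map_sum]
      exact Finset.sum_eq_zero (fun i _ => by rw [LinearMap.lTensor_tmul, l2])
    rw [← coassoc_symm_apply, l4] at l3
    simpa [hφ] using l3
  · intro ρ hρ
    have e1 : ∀ b : A, (LinearMap.lTensor A (ρ ∘ₗ LinearMap.mulLeft k b)) (comul (R := k) h) = 0 := by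
      intro a
      have g1 : ∀ t : A ⊗[k] A, (LinearMap.lTensor A (ρ ∘ₗ LinearMap.mulLeft k a)) t
          = LinearMap.lTensor A ρ (((1 : A) ⊗ₜ[k] a) * t) := by
        intro t
        induction t with
        | zero => simp
        | tmul y z => simp
        | add u v hu hv => simp only [map_add, mul_add, hu, hv]
      have g2 : ∀ t : A ⊗[k] A, LinearMap.lTensor A ρ ((antipode k a ⊗ₜ[k] (1 : A)) * t)
          = LinearMap.rTensor k (LinearMap.mulLeft k (antipode k a)) (LinearMap.lTensor A ρ t) := by
        intro t
        induction t with
        | zero => simp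
        | tmul y z => simp
        | add u v hu hv => simp only [map_add, mul_add, hu, hv]
      rw [g1, aux_key h hleft, g2, hρ, map_zero]
    obtain ⟨c, hc⟩ := TensorProduct.eq_repr_basis_left (N := A) B (comul (R := k) h)
    have e2 : ∀ b i, ρ (b * c i) = 0 := by
      intro b i
      have := e1 b
      rw [← hc, Finsupp.sum, map_sum] at this
      have h0 := TensorProduct.sum_tmul_basis_left_eq_zero (R := k) B
        (c.mapRange (ρ ∘ₗ LinearMap.mulLeft k b) (map_zero _)) (by
          rw [Finsupp.sum_mapRange_index (by simp)]
          simpa [Finsupp.sum] using this)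
      simpa using DFunLike.congr_fun h0 i
    let m : A ⊗[k] A →ₗ[k] A := LinearMap.mul' k A ∘ₗ (antipode k).rTensor A
    have hm : ∀ x : A, m (comul x) = algebraMap k A (counit x) :=
      fun x => mul_antipode_rTensor_comul_apply x
    ext b
    let Ω : A ⊗[k] (A ⊗[k] A) →ₗ[k] k := LinearMap.mul' k k ∘ₗ
      TensorProduct.map φ (ρ ∘ₗ LinearMap.mulLeft k b ∘ₗ m)
    have l1 : ∀ t : A ⊗[k] A, Ω (comul.lTensor A t) =
        ρ b * φ (TensorProduct.rid k A (counit.lTensor A t)) := by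
      intro t
      induction t with
      | zero => simp
      | tmul y z => simp [Ω, hm, Algebra.algebraMap_eq_smul_one]; ring
      | add u v hu hv => simp only [map_add, mul_add, hu, hv]
    have l2 : ∀ i, ∀ w : A ⊗[k] A, Ω ((TensorProduct.assoc k A A A) (w ⊗ₜ c i)) = 0 := by
      intro i w
      induction w with
      | zero => simp
      | tmul y z => simp [Ω, m, ← mul_assoc, e2]
      | add u v hu hv => simp only [add_tmul, map_add, hu, hv, add_zero]
    have l3 := l1 (comul h)
    have l4 : Ω (TensorProduct.assoc k A A A (comul.rTensor A (comul h))) = 0 := by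
      rw [← hc, Finsupp.sum, map_sum, map_sum, map_sum]
      exact Finset.sum_eq_zero (fun i _ => by rw [LinearMap.rTensor_tmul, l2])
    rw [← coassoc_apply, l4] at l3
    simpa [hφ] using l3
end

section
/- Let A be a Hopf algebra over a field k whose antipode S is bijective, let h ∈ A be a nonzero left cointegral, and let ω : A → k be a faithful linear functional. Then every element of A is of the form (ω(·a) ⊗ id)(Δ(h)) for some a ∈ A; that is, the linear map sending a ∈ A to the result of applying the functional b ↦ ω(b·a) to the first tensor leg of Δ(h) is surjective onto A. -/
open Coalgebra HopfAlgebra TensorProduct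

/-- `∑ (S x₁ ⊗ 1) Δ(x₂) = 1 ⊗ x`. -/
lemma aux_one {k A : Type*} [Field k] [Ring A] [HopfAlgebra k A] (x : A) {ι : Type*}
    (r : Coalgebra.Repr k x ι) :
    ∑ i ∈ r.index, ((antipode k (r.left i)) ⊗ₜ[k] (1 : A)) * comul (R := k) (r.right i)
      = (1 : A) ⊗ₜ[k] x := by
  have key : ∀ (a : A) (t : A ⊗[k] A), (antipode k a ⊗ₜ[k] (1 : A)) * t =
      LinearMap.rTensor A (LinearMap.mul' k A ∘ₗ LinearMap.rTensor A (antipode k))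
        ((TensorProduct.assoc k A A A).symm (a ⊗ₜ[k] t)) := by
    intro a t
    induction t using TensorProduct.induction_on with
    | zero => simp
    | tmul b c => simp
    | add y z hy hz => rw [mul_add, hy, hz, TensorProduct.tmul_add, map_add, map_add]
  have h1 : ∑ i ∈ r.index, (r.left i) ⊗ₜ[k] comul (R := k) (r.right i)
      = LinearMap.lTensor A (comul (R := k)) (comul (R := k) x) := by
    rw [← r.eq]; simp
  simp_rw [key]
  rw [← map_sum, ← map_sum, h1, Coalgebra.coassoc_symm_apply, ← LinearMap.comp_apply,
    ← LinearMap.rTensor_comp, LinearMap.comp_assoc, HopfAlgebra.mul_antipode_rTensor_comul,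
    LinearMap.rTensor_comp, LinearMap.comp_apply, Coalgebra.rTensor_counit_comul]
  simp

lemma aux_two {k A : Type*} [Field k] [Ring A] [HopfAlgebra k A]
    (h : A) (hleft : ∀ a : A, a * h = counit (R := k) a • h) (x : A) :
    ((1 : A) ⊗ₜ[k] x) * comul (R := k) h = (antipode k x ⊗ₜ[k] (1 : A)) * comul (R := k) h := by
  have r := Coalgebra.Repr.arbitrary k x
  rw [← aux_one x r, Finset.sum_mul]
  simp_rw [mul_assoc, ← Bialgebra.comul_mul, hleft, map_smul, mul_smul_comm, ← smul_mul_assoc]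
  rw [← Finset.sum_mul]
  congr 1
  simp_rw [TensorProduct.smul_tmul', ← map_smul]
  rw [← TensorProduct.sum_tmul, ← map_sum]
  have e := congrArg (TensorProduct.rid k A) (Coalgebra.sum_tmul_counit_eq r)
  simp only [map_sum, TensorProduct.rid_tmul, one_smul] at e
  rw [e]

/-- If the antipode of a Hopf algebra `A` over a field `k` is bijective, `h` is a
nonzero left cointegral, and `ω : A → k` is a faithful linear functional, then every element
of `A` equals `(ω(·a) ⊗ id)(Δ(h))` for some `a ∈ A`. -/
theorem stmt7 {k A : Type*} [Field k] [Ring A] [HopfAlgebra k A]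
    (hS : Function.Bijective (antipode (R := k) (A := A)))
    (h : A) (hh : h ≠ 0) (hleft : ∀ a : A, a * h = counit (R := k) a • h)
    (ω : A →ₗ[k] k)
    (hω₁ : ∀ x : A, (∀ b : A, ω (x * b) = 0) → x = 0)
    (hω₂ : ∀ x : A, (∀ b : A, ω (b * x) = 0) → x = 0) :
    ∀ x : A, ∃ a : A,
      (TensorProduct.lid k A)
        ((LinearMap.rTensor A (ω ∘ₗ LinearMap.mulRight k a)) (comul (R := k) h)) = x := by
  intro x
  classical
  let B := Module.Basis.ofVectorSpace k A
  obtain ⟨c, hc⟩ := TensorProduct.eq_repr_basis_left B (comul (R := k) h)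
  rw [Finsupp.sum] at hc
  -- surjectivity onto scalars
  have surj : ∀ t : c.support → k, ∃ a : A, ∀ i : c.support, ω (B i * a) = t i := by
    let T : A →ₗ[k] (c.support → k) := LinearMap.pi fun i => ω ∘ₗ LinearMap.mulLeft k (B i)
    have hT : LinearMap.range T = ⊤ := by
      by_contra hne
      obtain ⟨φ, hφ, hle⟩ := Submodule.exists_le_ker_of_lt_top _ (lt_top_iff_ne_top.mpr hne)
      apply hφ
      have h0 : ∑ i : c.support, φ (Pi.single i 1) • B i = 0 := by
        apply hω₁
        intro b
        have h2 : φ (T b) = 0 := hle ⟨b, rfl⟩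
        rw [LinearMap.pi_apply_eq_sum_univ φ] at h2
        rw [Finset.sum_mul, map_sum, ← h2]
        refine Finset.sum_congr rfl fun i _ => ?_
        have e : (fun j => if i = j then (1 : k) else 0) = Pi.single i 1 := by
          ext j; simp [Pi.single_apply, eq_comm]
        rw [e]
        simp [T, mul_comm]
      have li : LinearIndependent k (fun i : c.support => B i) :=
        B.linearIndependent.comp _ Subtype.val_injective
      have h3 := Fintype.linearIndependent_iff.mp li _ h0
      apply LinearMap.pi_ext'
      intro i
      ext
      simpa using h3 i
    intro t
    obtain ⟨a, ha⟩ := LinearMap.range_eq_top.mp hT t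
    exact ⟨a, fun i => congrFun ha i⟩
  -- the span
  suffices hx : ∀ x : A, x ∈ Submodule.span k (Set.range fun i : c.support => c i) by
    obtain ⟨t, ht⟩ := (Submodule.mem_span_range_iff_exists_fun k).mp (hx x)
    obtain ⟨a, ha⟩ := surj t
    refine ⟨a, ?_⟩
    rw [← hc, ← Finset.sum_coe_sort, map_sum, map_sum, ← ht]
    refine Finset.sum_congr rfl fun i _ => ?_
    simp [ha i]
  clear x
  set V := Submodule.span k (Set.range fun i : c.support => c i) with hV
  have hmemV : ∀ i ∈ c.support, c i ∈ V := fun i hi => Submodule.subset_span ⟨⟨i, hi⟩, rfl⟩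
  have ideal : ∀ (y : A), ∀ i ∈ c.support, y * c i ∈ V := by
    intro y i hi
    have e := aux_two h hleft y
    rw [← hc, Finset.mul_sum, Finset.mul_sum] at e
    have e2 := congrArg (fun t => TensorProduct.lid k A (LinearMap.rTensor A (B.coord i) t)) e
    simp only [Algebra.TensorProduct.tmul_mul_tmul, one_mul, map_sum, LinearMap.rTensor_tmul,
      TensorProduct.lid_tmul, Module.Basis.coord_apply, Module.Basis.repr_self] at e2
    rw [Finset.sum_eq_single i] at e2
    · simp only [Finsupp.single_eq_same, one_smul] at e2
      rw [e2]
      exact Submodule.sum_mem _ fun j hj => Submodule.smul_mem _ _ (hmemV j hj)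
    · intro j _ hji
      simp [Finsupp.single_apply, hji]
    · intro hn; exact absurd hi hn
  obtain ⟨f, hf⟩ : ∃ f : A →ₗ[k] k, f h = 1 := by
    exact Module.Projective.exists_dual_eq_one k hh
  -- unit
  have one : ∃ d : _ → A, (1 : A) = ∑ i ∈ c.support, d i * c i := by
    refine ⟨fun i => antipode k (TensorProduct.lid k A (LinearMap.rTensor A f (comul (R := k) (B i)))), ?_⟩
    let M : A ⊗[k] A →ₗ[k] A := LinearMap.mul' k A ∘ₗ LinearMap.rTensor A (antipode k)
    let G : A ⊗[k] (A ⊗[k] A) →ₗ[k] A :=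
      (TensorProduct.lid k A).toLinearMap ∘ₗ TensorProduct.map f M
    have e := congrArg G (Coalgebra.coassoc_apply (R := k) h)
    have hr : G (LinearMap.lTensor A (comul (R := k)) (comul (R := k) h)) = 1 := by
      have : G ∘ₗ LinearMap.lTensor A (comul (R := k)) =
          (Algebra.linearMap k A ∘ₗ f) ∘ₗ (TensorProduct.rid k A).toLinearMap ∘ₗ
            LinearMap.lTensor A (counit (R := k)) := by
        ext a b
        simp [G, M, Algebra.algebraMap_eq_smul_one, smul_smul, mul_comm]
      rw [← LinearMap.comp_apply, this]
      simp [hf]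
    have hl : ∀ (t : A ⊗[k] A) (q : A), G (TensorProduct.assoc k A A A (t ⊗ₜ[k] q)) =
        antipode k (TensorProduct.lid k A (LinearMap.rTensor A f t)) * q := by
      intro t q
      induction t using TensorProduct.induction_on with
      | zero => simp
      | tmul b c => simp [G, M]
      | add y z hy hz => simp only [TensorProduct.add_tmul, map_add, hy, hz, add_mul]
    rw [hr, ← hc] at e
    rw [← e]
    simp only [map_sum, LinearMap.rTensor_tmul, hl]
  obtain ⟨d, hd⟩ := one
  intro x
  rw [← mul_one x, hd, Finset.mul_sum]
  refine Submodule.sum_mem _ fun i hi => ?_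
  rw [← mul_assoc]
  exact ideal _ i hi
end

section
/- Let A be a Hopf algebra over a field k whose antipode S is bijective. If A possesses a nonzero left cointegral, then A is finite-dimensional as a k-vector space. -/
open Coalgebra HopfAlgebra

section Helpers

open TensorProduct WithConv

/-- `(S(a₁) ⊗ 1) Δ(a₂) = 1 ⊗ a`, as an identity of convolution products. -/
lemma helper_conv {k A : Type*} [Field k] [Ring A] [HopfAlgebra k A] :
    toConv ((Algebra.TensorProduct.includeLeft : A →ₐ[k] A ⊗[k] A).toLinearMap ∘ₗ antipode k (A := A)) *
      toConv (comul (R := k) (A := A)) =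
    toConv ((Algebra.TensorProduct.includeRight : A →ₐ[k] A ⊗[k] A).toLinearMap) := by
  have h1 : toConv (comul (R := k) (A := A)) =
      toConv ((Algebra.TensorProduct.includeLeft : A →ₐ[k] A ⊗[k] A).toLinearMap) *
      toConv ((Algebra.TensorProduct.includeRight : A →ₐ[k] A ⊗[k] A).toLinearMap) := by
    ext a
    rw [(ℛ k a).convMul_apply]
    simp [(ℛ k a).eq]
  have h2 : toConv ((Algebra.TensorProduct.includeLeft : A →ₐ[k] A ⊗[k] A).toLinearMap ∘ₗ
        antipode k (A := A)) *
      toConv ((Algebra.TensorProduct.includeLeft : A →ₐ[k] A ⊗[k] A).toLinearMap) = 1 := by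
    ext a
    rw [(ℛ k a).convMul_apply]
    have := congrArg (Algebra.TensorProduct.includeLeft : A →ₐ[k] A ⊗[k] A)
      (sum_antipode_mul_eq_algebraMap_counit (ℛ k a))
    rw [map_sum] at this
    simpa using this
  rw [h1, ← mul_assoc, h2, one_mul]

/-- `(1 ⊗ a) Δ(h) = (S(a) ⊗ 1) Δ(h)` for a left cointegral `h`. -/
lemma helper_shift {k A : Type*} [Field k] [Ring A] [HopfAlgebra k A] (h : A)
    (hh : ∀ a : A, a * h = counit (R := k) a • h) (a : A) :
    ((1 : A) ⊗ₜ[k] a) * comul (R := k) h = (antipode k a ⊗ₜ[k] (1 : A)) * comul (R := k) h := by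
  have h1 := congrArg (fun F => F.ofConv a) (helper_conv (k := k) (A := A))
  have h2 := (ℛ k a).convMul_apply (toConv
    ((Algebra.TensorProduct.includeLeft : A →ₐ[k] A ⊗[k] A).toLinearMap ∘ₗ antipode k (A := A)))
    (toConv (comul (R := k) (A := A)))
  have h3 : (1 : A) ⊗ₜ[k] a = ∑ i ∈ (ℛ k a).index,
      (antipode k ((ℛ k a).left i) ⊗ₜ[k] (1 : A)) * comul (R := k) ((ℛ k a).right i) :=
    h1.symm.trans h2
  rw [h3, Finset.sum_mul]
  have h4 : antipode k a = ∑ i ∈ (ℛ k a).index,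
      counit (R := k) ((ℛ k a).right i) • antipode k ((ℛ k a).left i) := by
    have h5 := congrArg (TensorProduct.rid k A) (sum_map_tmul_counit_eq (R := k)
      (antipode k (A := A)) a (repr := ℛ k a))
    simp only [map_sum, TensorProduct.rid_tmul, one_smul] at h5
    exact h5.symm
  rw [h4, TensorProduct.sum_tmul, Finset.sum_mul]
  refine Finset.sum_congr rfl fun i _ => ?_
  rw [mul_assoc, ← Bialgebra.comul_mul, hh, map_smul, mul_smul_comm, ← TensorProduct.smul_tmul',
    smul_mul_assoc]

/-- The identity `F * S * id = F` evaluated at `h`. -/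
lemma helper_G {k A : Type*} [Field k] [Ring A] [HopfAlgebra k A] (F : A →ₗ[k] A) :
    ∃ G : A →ₗ[k] A, ∀ h : A,
      LinearMap.mul' k A (TensorProduct.map G LinearMap.id (comul (R := k) h)) = F h := by
  refine ⟨(toConv F * toConv (antipode k (A := A))).ofConv, fun h => ?_⟩
  have : toConv F * toConv (antipode k (A := A)) * toConv LinearMap.id = toConv F := by
    rw [mul_assoc, LinearMap.antipode_mul_id, mul_one]
  exact congrArg (fun F => F.ofConv h) this

end Helpers

/-- A Hopf algebra over a field with bijective antipode that possesses a nonzero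
left cointegral is finite-dimensional. -/
theorem stmt8 {k A : Type*} [Field k] [Ring A] [HopfAlgebra k A]
    (hS : Function.Bijective (antipode (R := k) (A := A)))
    (hex : ∃ h : A, h ≠ 0 ∧ ∀ a : A, a * h = counit (R := k) a • h) :
    FiniteDimensional k A := by
  classical
  obtain ⟨h, h0, hh⟩ := hex
  let b := Module.Basis.ofVectorSpace k A
  obtain ⟨c, hc⟩ := TensorProduct.eq_repr_basis_left b (comul (R := k) h)
  rw [Finsupp.sum] at hc
  let V : Submodule k A := Submodule.span k (c.support.image c : Finset A)
  have hcV : ∀ i, c i ∈ V := by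
    intro i
    by_cases hi : i ∈ c.support
    · exact Submodule.subset_span (Finset.mem_coe.2 (Finset.mem_image_of_mem _ hi))
    · rw [Finsupp.notMem_support_iff.1 hi]; exact V.zero_mem
  have key : ∀ (a : A), ∀ i ∈ c.support, a * c i ∈ V := by
    intro a i hi
    have h1 := helper_shift h hh a
    rw [← hc, Finset.mul_sum, Finset.mul_sum] at h1
    simp only [Algebra.TensorProduct.tmul_mul_tmul, one_mul] at h1
    have h2 := congrArg (fun t => TensorProduct.lid k A ((b.coord i).rTensor A t)) h1
    simp only [map_sum, LinearMap.rTensor_tmul, TensorProduct.lid_tmul, Module.Basis.coord_apply,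
      Module.Basis.repr_self, Finsupp.single_apply, ite_smul, one_smul, zero_smul,
      Finset.sum_ite_eq', if_pos hi] at h2
    rw [h2]
    exact V.sum_mem fun j _ => V.smul_mem _ (hcV j)
  obtain ⟨f, hf⟩ := Module.Projective.exists_dual_ne_zero k h0
  have top : V = ⊤ := by
    rw [eq_top_iff]
    intro a _
    obtain ⟨G, hG⟩ := helper_G (k := k) (f.smulRight a)
    have h3 := hG h
    rw [← hc] at h3
    simp only [map_sum, TensorProduct.map_tmul, LinearMap.mul'_apply, LinearMap.id_apply,
      LinearMap.smulRight_apply] at h3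
    have h4 : f h • a ∈ V := by
      rw [← h3]
      exact V.sum_mem fun j hj => key _ j hj
    exact (V.smul_mem_iff hf).1 h4
  refine ⟨⟨c.support.image c, top⟩⟩
end

section
/- Let A be a Hopf algebra over a field k whose antipode S is bijective, and let h ∈ A be a nonzero left cointegral. Then there exists a linear functional φ : A → k with φ(h) = 1 that is left invariant, i.e. (id ⊗ φ)(Δ(a)) = φ(a)·1 for all a ∈ A, and there exists a nonzero linear functional ψ : A → k that is right invariant, i.e. (ψ ⊗ id)(Δ(a)) = ψ(a)·1 for all a ∈ A. -/
open Coalgebra HopfAlgebra TensorProduct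

section
variable {k A : Type*} [Field k] [Ring A] [HopfAlgebra k A]

/-- slice on the right -/
noncomputable def slR (f : A →ₗ[k] k) : A →ₗ[k] A :=
  (TensorProduct.rid k A).toLinearMap ∘ₗ LinearMap.lTensor A f ∘ₗ comul

noncomputable def slL (f : A →ₗ[k] k) : A →ₗ[k] A :=
  (TensorProduct.lid k A).toLinearMap ∘ₗ LinearMap.rTensor A f ∘ₗ comul

lemma comul_slR (f : A →ₗ[k] k) (a : A) :
    comul (R := k) (slR f a) = LinearMap.lTensor A (slR f) (comul (R := k) a) := by
  have h1 : ∀ t : A ⊗[k] A, comul (R := k) ((TensorProduct.rid k A) (LinearMap.lTensor A f t)) =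
      LinearMap.lTensor A ((TensorProduct.rid k A).toLinearMap ∘ₗ LinearMap.lTensor A f)
        (TensorProduct.assoc k A A A (LinearMap.rTensor A comul t)) := by
    intro t
    induction t with
    | zero => simp
    | add x y hx hy => simp only [map_add, hx, hy]
    | tmul x y =>
      simp only [LinearMap.lTensor_tmul, TensorProduct.rid_tmul, LinearMap.rTensor_tmul, map_smul]
      generalize comul (R := k) x = u
      induction u with
      | zero => simp
      | add x y hx hy => simp only [map_add, smul_add, hx, hy, TensorProduct.add_tmul]
      | tmul p q => simp
  have := h1 (comul (R := k) a)
  rw [Coalgebra.coassoc_apply] at this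
  simp only [slR, LinearMap.comp_apply, LinearEquiv.coe_coe, this]
  rw [← LinearMap.comp_apply, ← LinearMap.lTensor_comp]; rfl

lemma comul_slL (f : A →ₗ[k] k) (a : A) :
    comul (R := k) (slL f a) = LinearMap.rTensor A (slL f) (comul (R := k) a) := by
  have h1 : ∀ t : A ⊗[k] A, comul (R := k) ((TensorProduct.lid k A) (LinearMap.rTensor A f t)) =
      LinearMap.rTensor A ((TensorProduct.lid k A).toLinearMap ∘ₗ LinearMap.rTensor A f)
        ((TensorProduct.assoc k A A A).symm (LinearMap.lTensor A comul t)) := by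
    intro t
    induction t with
    | zero => simp
    | add x y hx hy => simp only [map_add, hx, hy]
    | tmul x y =>
      simp only [LinearMap.lTensor_tmul, TensorProduct.lid_tmul, LinearMap.rTensor_tmul, map_smul]
      generalize comul (R := k) y = u
      induction u with
      | zero => simp
      | add x y hx hy => simp only [map_add, smul_add, hx, hy, TensorProduct.tmul_add]
      | tmul p q => simp [TensorProduct.smul_tmul']
  have := h1 (comul (R := k) a)
  rw [Coalgebra.coassoc_symm_apply] at this
  simp only [slL, LinearMap.comp_apply, LinearEquiv.coe_coe, this]
  rw [← LinearMap.comp_apply (LinearMap.rTensor A _), ← LinearMap.rTensor_comp]; rfl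

lemma counit_slR (f : A →ₗ[k] k) (a : A) : counit (R := k) (slR f a) = f a := by
  have h1 : ∀ t : A ⊗[k] A, counit (R := k) ((TensorProduct.rid k A) (LinearMap.lTensor A f t)) =
      f (TensorProduct.lid k A (LinearMap.rTensor A counit t)) := by
    intro t
    induction t with
    | zero => simp
    | add x y hx hy => simp only [map_add, hx, hy]
    | tmul x y => simp [mul_comm]
  have := h1 (comul (R := k) a)
  simpa [slR] using this

/-- S(a₁)a₂ ⊗ a₃ = 1 ⊗ a -/
lemma key (a : A) :
    LinearMap.rTensor A (LinearMap.mul' k A ∘ₗ LinearMap.rTensor A (antipode k))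
      ((TensorProduct.assoc k A A A).symm (LinearMap.lTensor A comul (comul (R := k) a))) =
      (1 : A) ⊗ₜ[k] a := by
  rw [Coalgebra.coassoc_symm_apply, ← LinearMap.comp_apply, ← LinearMap.rTensor_comp,
    LinearMap.comp_assoc, HopfAlgebra.mul_antipode_rTensor_comul, LinearMap.rTensor_comp,
    LinearMap.comp_apply, Coalgebra.rTensor_counit_comul]
  simp

lemma move (h : A) (hleft : ∀ a : A, a * h = counit (R := k) a • h) (a : A) :
    ((1 : A) ⊗ₜ[k] a) * comul (R := k) h = (antipode k a ⊗ₜ[k] (1 : A)) * comul (R := k) h := by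
  rw [← key a]
  have h1 : ∀ t : A ⊗[k] A,
    LinearMap.rTensor A (LinearMap.mul' k A ∘ₗ LinearMap.rTensor A (antipode k))
      ((TensorProduct.assoc k A A A).symm (LinearMap.lTensor A comul t)) * comul (R := k) h =
      (antipode k (TensorProduct.rid k A (LinearMap.lTensor A counit t)) ⊗ₜ[k] (1 : A))
        * comul (R := k) h := by
    intro t
    induction t with
    | zero => simp
    | add x y hx hy => simp only [map_add, add_mul, hx, hy, TensorProduct.add_tmul]
    | tmul x y =>
      have h2 : ∀ u : A ⊗[k] A,
        LinearMap.rTensor A (LinearMap.mul' k A ∘ₗ LinearMap.rTensor A (antipode k))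
          ((TensorProduct.assoc k A A A).symm (x ⊗ₜ u)) = (antipode k x ⊗ₜ[k] (1 : A)) * u := by
        intro u
        induction u with
        | zero => simp
        | add x y hx hy => simp only [map_add, mul_add, hx, hy, TensorProduct.tmul_add]
        | tmul p q => simp
      rw [LinearMap.lTensor_tmul, h2, mul_assoc, ← Bialgebra.comul_mul, hleft]
      simp [← TensorProduct.smul_tmul']
  rw [h1]
  simp

lemma slR_move (h : A) (hleft : ∀ a : A, a * h = counit (R := k) a • h) (a : A)
    (f : A →ₗ[k] k) :
    slR (f ∘ₗ LinearMap.mulLeft k a) h = antipode k a * slR f h := by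
  have h1 : ∀ t : A ⊗[k] A, TensorProduct.rid k A
      (LinearMap.lTensor A (f ∘ₗ LinearMap.mulLeft k a) t) =
      TensorProduct.rid k A (LinearMap.lTensor A f ((1 ⊗ₜ a) * t)) := by
    intro t
    induction t with
    | zero => simp
    | add x y hx hy => simp only [map_add, mul_add, hx, hy]
    | tmul x y => simp
  have h2 : ∀ t : A ⊗[k] A, antipode k a * TensorProduct.rid k A (LinearMap.lTensor A f t) =
      TensorProduct.rid k A (LinearMap.lTensor A f ((antipode k a ⊗ₜ 1) * t)) := by
    intro t
    induction t with
    | zero => simp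
    | add x y hx hy => simp only [map_add, mul_add, hx, hy]
    | tmul x y => simp
  simp only [slR, LinearMap.comp_apply, LinearEquiv.coe_coe, h1, h2, move h hleft]

/-- The map f ↦ (id ⊗ f)(Δ h) as a linear map. -/
noncomputable def sliceR (h : A) : (A →ₗ[k] k) →ₗ[k] A where
  toFun f := slR f h
  map_add' f g := by simp [slR, LinearMap.lTensor_add]
  map_smul' c f := by simp [slR, LinearMap.lTensor_smul]

noncomputable def sliceL (h : A) : (A →ₗ[k] k) →ₗ[k] A where
  toFun f := slL f h
  map_add' f g := by simp [slL, LinearMap.rTensor_add]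
  map_smul' c f := by simp [slL, LinearMap.rTensor_smul]

lemma finite_range (h : A) : FiniteDimensional k (LinearMap.range (sliceR (k := k) h)) := by
  obtain ⟨S, hS⟩ := TensorProduct.exists_finset (R := k) (comul (R := k) h)
  classical
  have : LinearMap.range (sliceR (k := k) h) ≤
      Submodule.span k ((S.image Prod.fst : Finset A) : Set A) := by
    rintro _ ⟨f, rfl⟩
    simp only [sliceR, slR, LinearMap.coe_mk, AddHom.coe_mk, LinearMap.comp_apply, hS, map_sum]
    refine Submodule.sum_mem _ fun i hi => ?_
    simp only [LinearMap.lTensor_tmul, LinearEquiv.coe_coe, TensorProduct.rid_tmul]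
    exact Submodule.smul_mem _ _ (Submodule.subset_span (by
      simp only [Finset.coe_image]; exact ⟨i, hi, rfl⟩))
  exact Submodule.finiteDimensional_of_le this

lemma mul_mem_range (hS : Function.Bijective (antipode (R := k) (A := A)))
    (h : A) (hleft : ∀ a : A, a * h = counit (R := k) a • h) (b x : A)
    (hx : x ∈ LinearMap.range (sliceR (k := k) h)) :
    b * x ∈ LinearMap.range (sliceR (k := k) h) := by
  obtain ⟨a, rfl⟩ := hS.2 b
  obtain ⟨f, rfl⟩ := hx
  exact ⟨_, slR_move h hleft a f⟩

lemma one_mem_range (hS : Function.Bijective (antipode (R := k) (A := A)))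
    (h : A) (hh : h ≠ 0) (hleft : ∀ a : A, a * h = counit (R := k) a • h) :
    (1 : A) ∈ LinearMap.range (sliceR (k := k) h) := by
  classical
  obtain ⟨f, hf⟩ : ∃ f : A →ₗ[k] k, f h = 1 := by
    have := mt (Module.forall_dual_apply_eq_zero_iff k h).1 hh
    push Not at this
    obtain ⟨f, hf⟩ := this
    exact ⟨(f h)⁻¹ • f, by simp [hf]⟩
  let T : A → A := Function.surjInv hS.2
  have hT : ∀ a, antipode k (T a) = a := Function.surjInv_eq hS.2
  let B := Module.Basis.ofVectorSpace k A
  have e1 : comul (R := k) h =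
      ((TensorProduct.equivFinsuppOfBasisRight B) (comul (R := k) h)).sum
        fun i m ↦ m ⊗ₜ[k] B i := by
    rw [← TensorProduct.equivFinsuppOfBasisRight_symm_apply, LinearEquiv.symm_apply_apply]
  set c := (TensorProduct.equivFinsuppOfBasisRight B) (comul (R := k) h) with hc
  have hcm : ∀ i, c i ∈ LinearMap.range (sliceR (k := k) h) := fun i =>
    ⟨B.coord i, by rw [hc, TensorProduct.equivFinsuppOfBasisRight_apply]; rfl⟩
  have e2 : (1 : A) = ∑ i ∈ c.support, T (slR f (B i)) * c i := by
    apply hS.1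
    rw [map_sum, antipode_one]
    have e3 := HopfAlgebra.mul_antipode_rTensor_comul_apply (R := k) (slR f h)
    rw [counit_slR, hf, map_one, comul_slR, e1, Finsupp.sum] at e3
    rw [← e3]
    simp [HopfAlgebra.antipode_mul_antidistrib, hT]
  rw [e2]
  exact Submodule.sum_mem _ fun i _ => mul_mem_range hS h hleft _ _ (hcm i)

lemma pairing (f g : A →ₗ[k] k) (a : A) : f (slR g a) = g (slL f a) := by
  have h1 : ∀ t : A ⊗[k] A, f ((TensorProduct.rid k A) (LinearMap.lTensor A g t)) =
      g (TensorProduct.lid k A (LinearMap.rTensor A f t)) := by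
    intro t
    induction t with
    | zero => simp
    | add x y hx hy => simp only [map_add, hx, hy]
    | tmul x y => simp [mul_comm]
  exact h1 (comul (R := k) a)

end

/-- If the antipode of a Hopf algebra `A` over a field `k` is bijective and `h`
is a nonzero left cointegral, then there is a left-invariant functional `φ` with `φ h = 1`
and a nonzero right-invariant functional `ψ`. -/
theorem stmt9 {k A : Type*} [Field k] [Ring A] [HopfAlgebra k A]
    (hS : Function.Bijective (antipode (R := k) (A := A)))
    (h : A) (hh : h ≠ 0) (hleft : ∀ a : A, a * h = counit (R := k) a • h) :
    (∃ φ : A →ₗ[k] k, φ h = 1 ∧ ∀ a : A,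
      (TensorProduct.rid k A) ((LinearMap.lTensor A φ) (comul (R := k) a)) = φ a • (1 : A)) ∧
    (∃ ψ : A →ₗ[k] k, ψ ≠ 0 ∧ ∀ a : A,
      (TensorProduct.lid k A) ((LinearMap.rTensor A ψ) (comul (R := k) a)) = ψ a • (1 : A)) := by
  have hone := one_mem_range hS h hh hleft
  have htop : LinearMap.range (sliceR (k := k) h) = ⊤ := by
    rw [eq_top_iff]
    intro x _
    simpa using mul_mem_range hS h hleft x 1 hone
  have hsurj : Function.Surjective (sliceR (k := k) h) := LinearMap.range_eq_top.1 htop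
  haveI : FiniteDimensional k A := by
    have := finite_range (k := k) h
    rw [htop] at this
    exact Module.Finite.equiv (Submodule.topEquiv (R := k) (M := A))
  have hdim : Module.finrank k (A →ₗ[k] k) = Module.finrank k A := Subspace.dual_finrank_eq
  have hinj : Function.Injective (sliceR (k := k) h) :=
    (LinearMap.injective_iff_surjective_of_finrank_eq_finrank hdim).2 hsurj
  have hinj' : Function.Injective (sliceL (k := k) h) := by
    rw [injective_iff_map_eq_zero]
    intro f hf
    ext a
    obtain ⟨g, rfl⟩ := hsurj a
    have := pairing f g h
    change slL f h = 0 at hf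
    rw [hf, map_zero] at this
    exact this
  have hsurj' : Function.Surjective (sliceL (k := k) h) :=
    (LinearMap.injective_iff_surjective_of_finrank_eq_finrank hdim).1 hinj'
  have hnt : Nontrivial A := ⟨h, 0, hh⟩
  constructor
  · obtain ⟨φ, hφ⟩ := hone
    change slR φ h = 1 at hφ
    refine ⟨φ, by rw [← counit_slR, hφ, Bialgebra.counit_one], fun a => ?_⟩
    change slR φ a = _
    rw [← sub_eq_zero, ← Module.forall_dual_apply_eq_zero_iff k]
    intro g
    have : g ∘ₗ slR φ = g 1 • φ := by
      apply hinj
      rw [map_smul]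
      change slR (g ∘ₗ slR φ) h = g 1 • slR φ h
      have e := comul_slR φ h
      rw [hφ, Bialgebra.comul_one] at e
      have e' := congrArg (fun t => TensorProduct.rid k A (LinearMap.lTensor A g t)) e
      simp only [Algebra.TensorProduct.one_def, LinearMap.lTensor_tmul,
        TensorProduct.rid_tmul] at e'
      rw [hφ, e', slR, LinearMap.lTensor_comp]
      rfl
    have := LinearMap.congr_fun this a
    simp at this
    simp [this, mul_comm]
  · obtain ⟨ψ, hψ⟩ := hsurj' 1
    refine ⟨ψ, by rintro rfl; simp at hψ, fun a => ?_⟩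
    change slL ψ h = 1 at hψ
    change slL ψ a = _
    rw [← sub_eq_zero, ← Module.forall_dual_apply_eq_zero_iff k]
    intro g
    have : g ∘ₗ slL ψ = g 1 • ψ := by
      apply hinj'
      rw [map_smul]
      change slL (g ∘ₗ slL ψ) h = g 1 • slL ψ h
      have e := comul_slL ψ h
      rw [hψ, Bialgebra.comul_one] at e
      have e' := congrArg (fun t => TensorProduct.lid k A (LinearMap.rTensor A g t)) e
      simp only [Algebra.TensorProduct.one_def, LinearMap.rTensor_tmul,
        TensorProduct.lid_tmul] at e'
      rw [hψ, e', slL, LinearMap.rTensor_comp]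
      rfl
    have := LinearMap.congr_fun this a
    simp at this
    simp [this, mul_comm]
end

section
/- Let A be a Hopf algebra over a field k whose antipode S is bijective, and let h ∈ A be a nonzero element that is simultaneously a left cointegral and a right cointegral. Let φ : A → k be a faithful left-invariant functional with φ(h) = 1. Then S²(h) = h. -/
open Coalgebra HopfAlgebra TensorProduct

/-- If the antipode `S` of a Hopf algebra `A` over a field `k` is bijective,
`h` is a nonzero two-sided cointegral, and `φ` is a faithful left-invariant functional with
`φ h = 1`, then `S²(h) = h`. -/
theorem stmt12 {k A : Type*} [Field k] [Ring A] [HopfAlgebra k A]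
    (hS : Function.Bijective (antipode (R := k) (A := A)))
    (h : A) (hh : h ≠ 0)
    (hleft : ∀ a : A, a * h = counit (R := k) a • h)
    (hright : ∀ a : A, h * a = counit (R := k) a • h)
    (φ : A →ₗ[k] k) (hφh : φ h = 1)
    (hφ : ∀ a : A,
      (TensorProduct.rid k A) ((LinearMap.lTensor A φ) (comul (R := k) a)) = φ a • (1 : A))
    (hφ₁ : ∀ x : A, (∀ b : A, φ (x * b) = 0) → x = 0)
    (hφ₂ : ∀ x : A, (∀ b : A, φ (b * x) = 0) → x = 0) :
    antipode (R := k) (antipode (R := k) h) = h := by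
  clear hφ₁ hφ₂ hh hS
  suffices H : antipode k h = h by rw [H, H]
  -- `P w = (id ⊗ φ) (w * Δ h)`
  let E : A ⊗[k] A →ₗ[k] A := (TensorProduct.rid k A).toLinearMap ∘ₗ LinearMap.lTensor A φ
  have hE : ∀ x y : A, E (x ⊗ₜ y) = φ y • x := fun x y => by simp [E]
  have hE1 : ∀ (x : A) (w : A ⊗[k] A), E ((x ⊗ₜ 1) * w) = x * E w := by
    intro x w
    induction w with
    | zero => simp
    | add a b ha hb => rw [mul_add, map_add, ha, hb, map_add, mul_add]
    | tmul a b => rw [Algebra.TensorProduct.tmul_mul_tmul, hE, hE, one_mul, mul_smul_comm]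
  let P : A ⊗[k] A →ₗ[k] A := E ∘ₗ LinearMap.mulRight k (comul (R := k) h)
  have hP : ∀ w, P w = E (w * comul (R := k) h) := fun w => rfl
  have hP1 : ∀ (x : A) (w : A ⊗[k] A), P ((x ⊗ₜ 1) * w) = x * P w := by
    intro x w
    rw [hP, hP, mul_assoc, hE1]
  have hPΔ : ∀ a : A, P (comul (R := k) a) = counit (R := k) a • (1 : A) := by
    intro a
    rw [hP, ← Bialgebra.comul_mul, hleft, map_smul, map_smul]
    have := hφ h
    rw [hφh, one_smul] at this
    exact congrArg _ this
  let Q : A ⊗[k] (A ⊗[k] A) →ₗ[k] A :=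
    LinearMap.mul' k A ∘ₗ TensorProduct.map (antipode k) P
  have h1 : ∀ w : A ⊗[k] A, Q ((comul (R := k) (A := A)).lTensor A w)
      = antipode k (TensorProduct.rid k A ((counit (R := k) (A := A)).lTensor A w)) := by
    intro w
    induction w with
    | zero => simp
    | add a b ha hb => simp only [map_add, ha, hb]
    | tmul a b => simp [Q, hPΔ]
  have h2 : ∀ w : (A ⊗[k] A) ⊗[k] A, Q (TensorProduct.assoc k A A A w)
      = P ((LinearMap.mul' k A ∘ₗ (antipode k).rTensor A).rTensor A w) := by
    intro w
    induction w with
    | zero => simp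
    | add a b ha hb => simp only [map_add, ha, hb]
    | tmul u c =>
      induction u with
      | zero => simp
      | add a b ha hb => simp only [map_add, add_tmul, ha, hb]
      | tmul a b =>
        simp [Q, ← hP1]
  have h3 : P ((1 : A) ⊗ₜ[k] h) = h := by
    have : ∀ w : A ⊗[k] A, E (((1 : A) ⊗ₜ[k] h) * w)
        = TensorProduct.rid k A ((counit (R := k) (A := A)).lTensor A w) := by
      intro w
      induction w with
      | zero => simp
      | add a b ha hb => simp only [mul_add, map_add, ha, hb]
      | tmul a b =>
        rw [Algebra.TensorProduct.tmul_mul_tmul, hE, hright]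
        simp [hφh]
    rw [hP, this]
    simp
  have h4 : ((LinearMap.mul' k A ∘ₗ (antipode k).rTensor A).rTensor A)
      ((comul (R := k) (A := A)).rTensor A (comul (R := k) h)) = (1 : A) ⊗ₜ[k] h := by
    rw [← LinearMap.comp_apply, ← LinearMap.rTensor_comp, LinearMap.comp_assoc,
      HopfAlgebra.mul_antipode_rTensor_comul, LinearMap.rTensor_comp, LinearMap.comp_apply,
      Coalgebra.rTensor_counit_comul]
    simp
  have h5 := h1 (comul (R := k) h)
  rw [← Coalgebra.coassoc_apply, h2, h4, h3] at h5
  simpa using h5.symm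
end

section
/- Let A be a Hopf algebra over a field k, let h ∈ A be a nonzero left cointegral, and let φ : A → k be a faithful linear functional satisfying φ(h·a) = φ(a·h) for all a ∈ A (i.e. the modular automorphism of φ fixes h). Then h is also a right cointegral: h·a = ε(a)·h for all a ∈ A. -/
open Coalgebra HopfAlgebra

/-- If `h` is a nonzero left cointegral in a Hopf algebra `A` over a field `k`
and `φ` is a faithful linear functional with `φ(h·a) = φ(a·h)` for all `a`, then `h` is also
a right cointegral. -/
theorem stmt13 {k A : Type*} [Field k] [Ring A] [HopfAlgebra k A]
    (h : A) (hh : h ≠ 0)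
    (hleft : ∀ a : A, a * h = counit (R := k) a • h)
    (φ : A →ₗ[k] k)
    (hφ₁ : ∀ x : A, (∀ b : A, φ (x * b) = 0) → x = 0)
    (hφ₂ : ∀ x : A, (∀ b : A, φ (b * x) = 0) → x = 0)
    (hσ : ∀ a : A, φ (h * a) = φ (a * h)) :
    ∀ a : A, h * a = counit (R := k) a • h := by
  intro a
  rw [← sub_eq_zero]
  apply hφ₁
  intro b
  rw [sub_mul, map_sub, mul_assoc, hσ, hleft, smul_mul_assoc, map_smul, map_smul, hσ, hleft,
    map_smul, Bialgebra.counit_mul]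
  simp only [smul_eq_mul]
  ring
end

section
/- Let A be a Hopf algebra over a field k, let h ∈ A be a nonzero element that is simultaneously a left cointegral and a right cointegral, and let ω : A → k be a tracial linear functional, i.e. ω(a·b) = ω(b·a) for all a, b ∈ A. Define q := (ω ⊗ id)(Δ(h)) ∈ A, the result of applying ω to the first tensor leg of Δ(h). Then a·q = q·S²(a) for all a ∈ A. -/
open Coalgebra HopfAlgebra TensorProduct

lemma aux_left {k A : Type*} [Field k] [Ring A] [HopfAlgebra k A] (a : A) :
    ∑ i ∈ (ℛ k a).index, (antipode k ((ℛ k a).left i) ⊗ₜ[k] (1 : A)) *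
      comul (R := k) ((ℛ k a).right i) = (1 : A) ⊗ₜ[k] a := by
  let P : A ⊗[k] (A ⊗[k] A) →ₗ[k] A ⊗[k] A :=
    (LinearMap.mul' k A ∘ₗ (antipode k).rTensor A).rTensor A ∘ₗ
      (TensorProduct.assoc k A A A).symm.toLinearMap
  have hP : ∀ (x : A) (t : A ⊗[k] A), P (x ⊗ₜ t) = (antipode k x ⊗ₜ[k] (1 : A)) * t := by
    intro x t
    induction t using TensorProduct.induction_on with
    | zero => simp
    | tmul y z => simp [P]
    | add s t hs ht => rw [tmul_add, map_add, hs, ht, mul_add]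
  have h1 : P (comul.lTensor A (comul (R := k) a)) = (1 : A) ⊗ₜ[k] a := by
    simp only [P, LinearMap.comp_apply, LinearEquiv.coe_coe, coassoc_symm_apply]
    rw [← LinearMap.comp_apply, ← LinearMap.rTensor_comp, LinearMap.comp_assoc,
      mul_antipode_rTensor_comul, LinearMap.rTensor_comp, LinearMap.comp_apply,
      rTensor_counit_comul]
    simp
  rw [← h1]
  conv_rhs => rw [← (ℛ k a).eq]
  simp [hP]

lemma aux_right {k A : Type*} [Field k] [Ring A] [HopfAlgebra k A] (a : A) :
    ∑ i ∈ (ℛ k a).index, comul (R := k) ((ℛ k a).left i) *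
      ((1 : A) ⊗ₜ[k] antipode k ((ℛ k a).right i)) = a ⊗ₜ[k] (1 : A) := by
  let P : (A ⊗[k] A) ⊗[k] A →ₗ[k] A ⊗[k] A :=
    (LinearMap.mul' k A ∘ₗ (antipode k).lTensor A).lTensor A ∘ₗ
      (TensorProduct.assoc k A A A).toLinearMap
  have hP : ∀ (x : A) (t : A ⊗[k] A), P (t ⊗ₜ x) = t * ((1 : A) ⊗ₜ[k] antipode k x) := by
    intro x t
    induction t using TensorProduct.induction_on with
    | zero => simp
    | tmul y z => simp [P]
    | add s t hs ht => rw [add_tmul, map_add, hs, ht, add_mul]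
  have h1 : P (comul.rTensor A (comul (R := k) a)) = a ⊗ₜ[k] (1 : A) := by
    simp only [P, LinearMap.comp_apply, LinearEquiv.coe_coe, coassoc_apply]
    rw [← LinearMap.comp_apply, ← LinearMap.lTensor_comp, LinearMap.comp_assoc,
      mul_antipode_lTensor_comul, LinearMap.lTensor_comp, LinearMap.comp_apply,
      lTensor_counit_comul]
    simp
  rw [← h1]
  conv_rhs => rw [← (ℛ k a).eq]
  simp [hP]

/-- If `h` is a nonzero two-sided cointegral in a Hopf algebra `A` over a field
`k` and `ω` is a tracial linear functional, then `q = (ω ⊗ id)(Δ(h))` satisfies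
`a·q = q·S²(a)` for all `a`. -/
theorem stmt15 {k A : Type*} [Field k] [Ring A] [HopfAlgebra k A]
    (h : A) (hh : h ≠ 0)
    (hleft : ∀ a : A, a * h = counit (R := k) a • h)
    (hright : ∀ a : A, h * a = counit (R := k) a • h)
    (ω : A →ₗ[k] k) (hω : ∀ a b : A, ω (a * b) = ω (b * a))
    (q : A)
    (hq : q = (TensorProduct.lid k A) ((LinearMap.rTensor A ω) (comul (R := k) h))) :
    ∀ a : A, a * q = q * antipode (R := k) (antipode (R := k) a) := by
  intro a
  have L : ((1 : A) ⊗ₜ[k] a) * comul (R := k) h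
      = (antipode k a ⊗ₜ[k] (1 : A)) * comul (R := k) h := by
    have e : ∑ i ∈ (ℛ k a).index, counit (R := k) ((ℛ k a).right i) • (ℛ k a).left i = a := by
      have := congrArg (TensorProduct.rid k A) (sum_tmul_counit_eq (ℛ k a))
      simpa only [map_sum, TensorProduct.rid_tmul, one_smul] using this
    rw [← aux_left a, Finset.sum_mul]
    conv_rhs => rw [← e]
    simp only [mul_assoc, ← Bialgebra.comul_mul, hleft, map_smul, map_sum, sum_tmul,
      Finset.sum_mul, mul_smul_comm, ← smul_tmul', smul_mul_assoc]
  have R : ∀ b : A, comul (R := k) h * (b ⊗ₜ[k] (1 : A))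
      = comul (R := k) h * ((1 : A) ⊗ₜ[k] antipode k b) := by
    intro b
    have e := sum_counit_smul (ℛ k b)
    rw [← aux_right b, Finset.mul_sum]
    conv_rhs => rw [← e]
    simp only [← mul_assoc, ← Bialgebra.comul_mul, hright, map_smul, map_sum, tmul_sum,
      Finset.mul_sum, mul_smul_comm, tmul_smul, smul_mul_assoc]
  let W : A ⊗[k] A →ₗ[k] A := (TensorProduct.lid k A).toLinearMap ∘ₗ LinearMap.rTensor A ω
  have hW : q = W (comul (R := k) h) := hq
  have w1 : ∀ (b : A) (t : A ⊗[k] A), W (((1 : A) ⊗ₜ[k] b) * t) = b * W t := by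
    intro b t
    induction t using TensorProduct.induction_on with
    | zero => simp
    | tmul y z => simp [W]
    | add s t hs ht => rw [mul_add, map_add, hs, ht, map_add, mul_add]
  have w2 : ∀ (b : A) (t : A ⊗[k] A), W (t * ((1 : A) ⊗ₜ[k] b)) = W t * b := by
    intro b t
    induction t using TensorProduct.induction_on with
    | zero => simp
    | tmul y z => simp [W]
    | add s t hs ht => rw [add_mul, map_add, hs, ht, map_add, add_mul]
  have w3 : ∀ (b : A) (t : A ⊗[k] A),
      W ((b ⊗ₜ[k] (1 : A)) * t) = W (t * (b ⊗ₜ[k] (1 : A))) := by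
    intro b t
    induction t using TensorProduct.induction_on with
    | zero => simp
    | tmul y z => simp [W, hω b y]
    | add s t hs ht => rw [mul_add, map_add, hs, ht, add_mul, map_add]
  rw [hW, ← w1, L, w3, R, w2]
end

section
/- Let ι be a nonempty finite index set, n : ι → ℕ with n(i) ≥ 1 for all i, and let A = ∏_{i∈ι} M_{n(i)}(ℂ) be the corresponding finite product of complex matrix algebras, a unital *-algebra with componentwise operations and star given by conjugate transpose in each component. Let ε : A → ℂ be a unital *-algebra homomorphism. Then there exists a unique nonzero self-adjoint idempotent h ∈ A (star h = h and h·h = h) such that a·h = ε(a)·h for all a ∈ A; moreover this h also satisfies h·a = ε(a)·h for all a ∈ A. -/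
/-- Let `A = ∏ i, M_{n i}(ℂ)` be a finite product of complex matrix algebras
(with `ι` nonempty finite and `n i ≥ 1`), and let `ε : A → ℂ` be a unital `*`-algebra
homomorphism. Then there is a unique nonzero self-adjoint idempotent `h ∈ A` with
`a * h = ε a • h` for all `a`; moreover this `h` also satisfies `h * a = ε a • h`
for all `a`. -/
theorem stmt16 {ι : Type*} [Fintype ι] [Nonempty ι] (n : ι → ℕ) (hn : ∀ i, 1 ≤ n i)
    (ε : (∀ i, Matrix (Fin (n i)) (Fin (n i)) ℂ) →⋆ₐ[ℂ] ℂ) :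
    ∃ h : ∀ i, Matrix (Fin (n i)) (Fin (n i)) ℂ,
      (h ≠ 0 ∧ star h = h ∧ h * h = h ∧ ∀ a, a * h = ε a • h) ∧
      (∀ a, h * a = ε a • h) ∧
      (∀ h' : ∀ i, Matrix (Fin (n i)) (Fin (n i)) ℂ,
        (h' ≠ 0 ∧ star h' = h' ∧ h' * h' = h' ∧ ∀ a, a * h' = ε a • h') → h' = h) := by
  classical
  -- some central idempotent has nonzero image
  obtain ⟨i, hi⟩ : ∃ i, ε (Pi.single i 1) ≠ 0 := by
    by_contra! H
    have h1 : ε (∑ i, Pi.single i (1 : Matrix (Fin (n i)) (Fin (n i)) ℂ)) = 0 := by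
      rw [map_sum]
      exact Finset.sum_eq_zero fun i _ => H i
    have h2 : (∑ i, Pi.single i (1 : Matrix (Fin (n i)) (Fin (n i)) ℂ)) = 1 :=
      Finset.univ_sum_single (1 : ∀ i, Matrix (Fin (n i)) (Fin (n i)) ℂ)
    rw [h2, map_one] at h1
    exact one_ne_zero h1
  haveI : Nonempty (Fin (n i)) := ⟨⟨0, hn i⟩⟩
  set h : ∀ i, Matrix (Fin (n i)) (Fin (n i)) ℂ := Pi.single i 1 with hh
  have hidem : h * h = h := by rw [hh, ← Pi.single_mul, mul_one]
  have hε : ε h = 1 := by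
    have : ε h * ε h = ε h := by rw [← map_mul, hidem]
    exact mul_left_cancel₀ hi (by rw [this, mul_one])
  let φ : Matrix (Fin (n i)) (Fin (n i)) ℂ →+* ℂ :=
    { toFun := fun M => ε (Pi.single i M)
      map_one' := hε
      map_mul' := fun M N => by rw [Pi.single_mul, map_mul]
      map_zero' := by rw [Pi.single_zero, map_zero]
      map_add' := fun M N => by rw [Pi.single_add, map_add] }
  have hφ : Function.Injective φ := RingHom.injective φ
  have hφs : ∀ (c : ℂ) M, φ (c • M) = c * φ M := fun c M => by
    change ε (Pi.single i (c • M)) = c * ε (Pi.single i M)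
    rw [Pi.single_smul, map_smul, smul_eq_mul]
  have hscal : ∀ M, M = φ M • (1 : Matrix (Fin (n i)) (Fin (n i)) ℂ) := fun M => by
    apply hφ
    rw [hφs, map_one, mul_one]
  have hah : ∀ a : (∀ i, Matrix (Fin (n i)) (Fin (n i)) ℂ), a * h = Pi.single i (a i) := by
    intro a
    rw [hh, ← Pi.single_mul_right, mul_one]
  have hha : ∀ a : (∀ i, Matrix (Fin (n i)) (Fin (n i)) ℂ), h * a = Pi.single i (a i) := by
    intro a
    rw [hh, ← Pi.single_mul_left, one_mul]
  have key : ∀ a : (∀ i, Matrix (Fin (n i)) (Fin (n i)) ℂ), a * h = ε a • h := by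
    intro a
    have h1 : ε a = φ (a i) := by
      change ε a = ε (Pi.single i (a i))
      rw [← hah, map_mul, hε, mul_one]
    rw [hah, h1, hh, ← Pi.single_smul, ← hscal]
  have hcomm : ∀ a, h * a = a * h := fun a => by rw [hah, hha]
  refine ⟨h, ⟨?_, ?_, hidem, key⟩, fun a => by rw [hcomm, key], ?_⟩
  · intro h0
    rw [h0, map_zero] at hε
    exact zero_ne_one hε
  · rw [hh, ← Pi.single_star, star_one]
  · rintro h' ⟨h0, -, h2, h3⟩
    have e1 : ε h' = 1 := by
      have h4 : ε h' • h' = (1 : ℂ) • h' := by rw [← h3, h2, one_smul]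
      exact smul_left_injective ℂ h0 h4
    have e2 : h * h' = h' := by rw [h3, hε, one_smul]
    rw [← e2, hcomm, key, e1, one_smul]
end
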